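/- Let H be a hyperplane of T and let u ∈ V'. Then: (1) if r·u ∈ H, then the set {[u+h] : h ∈ H} ⊆ V has cardinality |H|/q = q^{2e-2}; (2) if r·u ∉ H, then the set {[u+h] : h ∈ H} has cardinality |H| = q^{2e-1}. -/

import Mathlib

open Matrix

/-- The symplectic form `a M bᵀ` where `M = [[0, Iₑ],[-Iₑ, 0]]`. -/
def sympForm (K : Type) [CommRing K] (e : ℕ) (a b : Fin e ⊕ Fin e → K) : K :=
  a ⬝ᵥ ((Matrix.fromBlocks (0 : Matrix (Fin e) (Fin e) K) 1 (-1) 0) *ᵥ b)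

/-- `V'`: the set of 2e-tuples over `K` having at least one unit entry. -/
def unitTuples (K : Type) [CommRing K] (e : ℕ) : Set (Fin e ⊕ Fin e → K) :=
  {a | ∃ i, IsUnit (a i)}

/-- The equivalence class `[a]` of a tuple under unit scaling. -/
def cls (K : Type) [CommRing K] (e : ℕ) (a : Fin e ⊕ Fin e → K) :
    Set (Fin e ⊕ Fin e → K) :=
  {b | ∃ σ : Kˣ, b = σ • a}

/-- `V`: the set of equivalence classes of elements of `V'` under unit scaling. -/
def classes (K : Type) [CommRing K] (e : ℕ) : Set (Set (Fin e ⊕ Fin e → K)) :=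
  {S | ∃ a ∈ unitTuples K e, S = cls K e a}

/-- Adjacency in the graph `X(2e,K)`: `a M bᵀ ∈ K \ {0}`. -/
def adjX (K : Type) [CommRing K] (e : ℕ) (A B : Set (Fin e ⊕ Fin e → K)) : Prop :=
  ∃ a ∈ A, ∃ b ∈ B, sympForm K e a b ≠ 0

/-- Adjacency in the complement of `X(2e,K)`: distinct classes with `a M bᵀ = 0`. -/
def adjXc (K : Type) [CommRing K] (e : ℕ) (A B : Set (Fin e ⊕ Fin e → K)) : Prop :=
  A ≠ B ∧ ∃ a ∈ A, ∃ b ∈ B, sympForm K e a b = 0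

/-- Adjacency in the graph `Y(2e,K)`: `a M bᵀ ∈ J \ {0}`. -/
def adjY (K : Type) [CommRing K] (J : Ideal K) (e : ℕ)
    (A B : Set (Fin e ⊕ Fin e → K)) : Prop :=
  ∃ a ∈ A, ∃ b ∈ B, sympForm K e a b ∈ J ∧ sympForm K e a b ≠ 0

/-- `T = J × ⋯ × J` (2e factors), as a subset of `K^{2e}`. -/
def Tset (K : Type) [CommRing K] (J : Ideal K) (e : ℕ) : Set (Fin e ⊕ Fin e → K) :=
  {x | ∀ i, x i ∈ J}

/-- A hyperplane of `T`: a `K`-submodule contained in `T` of cardinality `q^(2e-1)`. -/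
def IsHyperplane (K : Type) [CommRing K] (J : Ideal K) (e q : ℕ)
    (H : Submodule K (Fin e ⊕ Fin e → K)) : Prop :=
  (H : Set (Fin e ⊕ Fin e → K)) ⊆ Tset K J e ∧ Nat.card H = q ^ (2 * e - 1)

/-- `C(H,u) = {[u+h] : h ∈ H}`. -/
def classSet (K : Type) [CommRing K] (e : ℕ) (H : Submodule K (Fin e ⊕ Fin e → K))
    (u : Fin e ⊕ Fin e → K) : Set (Set (Fin e ⊕ Fin e → K)) :=
  {S | ∃ h ∈ (H : Set (Fin e ⊕ Fin e → K)), S = cls K e (u + h)}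

/-- The set of tuples `{σ • (u+h) : σ ∈ Kˣ, h ∈ H}`. -/
def orbitSet (K : Type) [CommRing K] (e : ℕ) (H : Submodule K (Fin e ⊕ Fin e → K))
    (u : Fin e ⊕ Fin e → K) : Set (Fin e ⊕ Fin e → K) :=
  {x | ∃ σ : Kˣ, ∃ h ∈ (H : Set (Fin e ⊕ Fin e → K)), x = σ • (u + h)}

/-- The coset `c • u + T` of `T`. -/
def cosetOf (K : Type) [CommRing K] (J : Ideal K) (e : ℕ) (c : K)
    (u : Fin e ⊕ Fin e → K) : Set (Fin e ⊕ Fin e → K) :=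
  {x | ∃ t ∈ Tset K J e, x = c • u + t}

section UniqueNontrivialIdeal

variable {K : Type} [CommRing K] {J : Ideal K}

theorem isUnit_of_notMem_of_ideals (hideals : ∀ I : Ideal K, I = ⊥ ∨ I = J ∨ I = ⊤)
    {c : K} (hc : c ∉ J) : IsUnit c := by
  have hmem := Ideal.mem_span_singleton_self c
  rcases hideals (Ideal.span {c}) with h | h | h
  · rw [h, Ideal.mem_bot] at hmem
    exact absurd (hmem ▸ J.zero_mem) hc
  · exact absurd (h ▸ hmem) hc
  · exact Ideal.span_singleton_eq_top.mp h

theorem mul_self_eq_zero_of_ideals {r : K} (hJr : J = Ideal.span {r}) (hJtop : J ≠ ⊤)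
    (hideals : ∀ I : Ideal K, I = ⊥ ∨ I = J ∨ I = ⊤) : r * r = 0 := by
  have hr : r ∈ J := hJr ▸ Ideal.mem_span_singleton_self r
  rcases hideals (Ideal.span {r * r}) with h | h | h
  · exact Ideal.span_singleton_eq_bot.mp h
  · obtain ⟨c, hc⟩ := Ideal.mem_span_singleton'.mp (h ▸ hr)
    have hunit : IsUnit (1 - c * r) := isUnit_of_notMem_of_ideals hideals fun hmem =>
      hJtop ((Ideal.eq_top_iff_one J).mpr
        (by simpa using J.add_mem hmem (J.mul_mem_left c hr)))
    have hr0 : r = 0 := hunit.mul_left_eq_zero.mp (by linear_combination -hc)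
    simp [hr0]
  · exact absurd (hJr.trans (Ideal.span_singleton_eq_top.mpr
      (isUnit_of_mul_isUnit_left (Ideal.span_singleton_eq_top.mp h)))) hJtop

theorem mul_eq_zero_of_mem_of_mem {r : K} (hJr : J = Ideal.span {r}) (hr : r * r = 0)
    {x y : K} (hx : x ∈ J) (hy : y ∈ J) : x * y = 0 := by
  rw [hJr, Ideal.mem_span_singleton'] at hx hy
  obtain ⟨a, rfl⟩ := hx
  obtain ⟨b, rfl⟩ := hy
  linear_combination a * b * hr

theorem mul_eq_zero_iff_mem_of_ideals {r : K} (hJr : J = Ideal.span {r}) (hJbot : J ≠ ⊥)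
    (hJtop : J ≠ ⊤) (hideals : ∀ I : Ideal K, I = ⊥ ∨ I = J ∨ I = ⊤) {c : K} :
    c * r = 0 ↔ c ∈ J := by
  refine ⟨fun h => ?_, fun h => ?_⟩
  · by_contra hc
    have hr0 : r = 0 := (isUnit_of_notMem_of_ideals hideals hc).mul_right_eq_zero.mp h
    exact hJbot (by simp [hJr, hr0])
  · exact mul_eq_zero_of_mem_of_mem hJr (mul_self_eq_zero_of_ideals hJr hJtop hideals) h
      (hJr ▸ Ideal.mem_span_singleton_self r)

theorem card_ideal_eq_card_quotient {r : K} (hJr : J = Ideal.span {r}) (hJbot : J ≠ ⊥)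
    (hJtop : J ≠ ⊤) (hideals : ∀ I : Ideal K, I = ⊥ ∨ I = J ∨ I = ⊤) :
    Nat.card J = Nat.card (K ⧸ J) := by
  have hker : LinearMap.ker (LinearMap.toSpanSingleton K K r) = J := by
    ext c
    simp [mul_eq_zero_iff_mem_of_ideals hJr hJbot hJtop hideals]
  have hrange : LinearMap.range (LinearMap.toSpanSingleton K K r) = J := by
    rw [LinearMap.range_toSpanSingleton, hJr]
  have hcard := Nat.card_congr (LinearMap.toSpanSingleton K K r).quotKerEquivRange.toEquiv
  rw [hker, hrange] at hcard
  exact hcard.symm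

end UniqueNontrivialIdeal

section Classes

variable {K : Type} [CommRing K] {J : Ideal K} {e : ℕ}

theorem self_mem_cls (a : Fin e ⊕ Fin e → K) : a ∈ cls K e a :=
  ⟨1, (one_smul _ a).symm⟩

theorem cls_units_smul (σ : Kˣ) (a : Fin e ⊕ Fin e → K) : cls K e (σ • a) = cls K e a := by
  ext b
  constructor
  · rintro ⟨τ, rfl⟩
    exact ⟨τ * σ, smul_smul τ σ a⟩
  · rintro ⟨τ, rfl⟩
    exact ⟨τ * σ⁻¹, by rw [smul_smul, inv_mul_cancel_right]⟩

theorem cls_eq_cls_iff {a b : Fin e ⊕ Fin e → K} :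
    cls K e a = cls K e b ↔ ∃ σ : Kˣ, a = σ • b := by
  refine ⟨fun h => ?_, ?_⟩
  · have := self_mem_cls a
    rwa [h] at this
  · rintro ⟨σ, rfl⟩
    exact cls_units_smul σ b

/-- Over an ideal with zero square, translates of a tuple with a unit entry by tuples in the ideal
are equivalent exactly when the translations differ by a multiple of the tuple. -/
theorem cls_add_eq_cls_add_iff (hmul : ∀ x ∈ J, ∀ y ∈ J, x * y = 0)
    {u h h' : Fin e ⊕ Fin e → K} (hu : u ∈ unitTuples K e)
    (hh : h ∈ Tset K J e) (hh' : h' ∈ Tset K J e) :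
    cls K e (u + h) = cls K e (u + h') ↔ ∃ j ∈ J, j • u = h - h' := by
  rw [cls_eq_cls_iff]
  constructor
  · rintro ⟨σ, hσ⟩
    have hcoord (k : Fin e ⊕ Fin e) : u k + h k = σ * (u k + h' k) :=
      congrFun hσ k
    obtain ⟨i, hi⟩ := hu
    have hmem : (σ - 1 : K) ∈ J := by
      rw [← Ideal.mul_unit_mem_iff_mem J hi]
      have := J.sub_mem (hh i) (J.mul_mem_left (σ : K) (hh' i))
      convert this using 1
      linear_combination -hcoord i
    refine ⟨σ - 1, hmem, funext fun k => ?_⟩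
    simp only [Pi.smul_apply, Pi.sub_apply, smul_eq_mul]
    linear_combination -hcoord k - hmul _ hmem _ (hh' k)
  · rintro ⟨j, hj, hju⟩
    have hjj := hmul j hj j hj
    refine ⟨⟨1 + j, 1 - j, by linear_combination -hjj, by linear_combination -hjj⟩,
      funext fun k => ?_⟩
    have hk : j * u k = h k - h' k := by simpa using congrFun hju k
    simp only [Units.smul_def, Pi.smul_apply, Pi.add_apply, smul_eq_mul]
    linear_combination -hk - hmul _ hj _ (hh' k)

/-- The multiples of `u` by elements of `J` that lie in `H`. -/
def idealMultiples (J : Ideal K) (H : Submodule K (Fin e ⊕ Fin e → K))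
    (u : Fin e ⊕ Fin e → K) : Submodule K H :=
  (Submodule.map (LinearMap.toSpanSingleton K (Fin e ⊕ Fin e → K) u) J).comap H.subtype

theorem mem_idealMultiples {H : Submodule K (Fin e ⊕ Fin e → K)} {u : Fin e ⊕ Fin e → K}
    {h : H} : h ∈ idealMultiples J H u ↔ ∃ j ∈ J, j • u = h := by
  simp [idealMultiples]

theorem card_eq_card_classSet_mul (hmul : ∀ x ∈ J, ∀ y ∈ J, x * y = 0)
    {H : Submodule K (Fin e ⊕ Fin e → K)}
    (hH : (H : Set (Fin e ⊕ Fin e → K)) ⊆ Tset K J e)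
    {u : Fin e ⊕ Fin e → K} (hu : u ∈ unitTuples K e) :
    Nat.card H = Nat.card (classSet K e H u) * Nat.card (idealMultiples J H u) := by
  have hrel (h h' : H) : cls K e (u + h) = cls K e (u + h') ↔ h - h' ∈ idealMultiples J H u := by
    rw [cls_add_eq_cls_add_iff hmul hu (hH h.2) (hH h'.2), mem_idealMultiples]
    rfl
  let f : H ⧸ idealMultiples J H u → classSet K e H u :=
    Quotient.lift (fun h : H => (⟨cls K e (u + h), h, h.2, rfl⟩ : classSet K e H u))
      fun h h' hhh => Subtype.ext
        ((hrel h h').mpr ((Submodule.quotientRel_def _).mp hhh))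
  have hf : Function.Bijective f := by
    constructor
    · rintro ⟨h⟩ ⟨h'⟩ heq
      exact (Submodule.Quotient.eq _).mpr ((hrel h h').mp (congrArg Subtype.val heq))
    · rintro ⟨_, h, hh, rfl⟩
      exact ⟨Submodule.Quotient.mk ⟨h, hh⟩, rfl⟩
  rw [Submodule.card_eq_card_quotient_mul_card (idealMultiples J H u),
    Nat.card_eq_of_bijective f hf, mul_comm]

theorem card_idealMultiples_of_smul_mem {r : K} (hJr : J = Ideal.span {r})
    {H : Submodule K (Fin e ⊕ Fin e → K)} {u : Fin e ⊕ Fin e → K} (hu : u ∈ unitTuples K e)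
    (hru : r • u ∈ H) : Nat.card (idealMultiples J H u) = Nat.card J := by
  have hmem (j : J) : (j : K) • u ∈ H := by
    obtain ⟨c, hc⟩ := Ideal.mem_span_singleton'.mp (hJr.le j.2)
    rw [← hc, mul_smul]
    exact H.smul_mem c hru
  refine (Nat.card_eq_of_bijective (fun j : J => (⟨⟨(j : K) • u, hmem j⟩,
    mem_idealMultiples.mpr ⟨j, j.2, rfl⟩⟩ : idealMultiples J H u)) ⟨fun j j' heq => ?_, ?_⟩).symm
  · obtain ⟨i, hi⟩ := hu
    have hsmul : (j : K) • u = (j' : K) • u := congrArg (fun x => (x.1 : Fin e ⊕ Fin e → K)) heq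
    exact Subtype.ext (hi.mul_left_injective (by simpa using congrFun hsmul i))
  · rintro ⟨⟨h, hh⟩, hhN⟩
    obtain ⟨j, hj, rfl⟩ := mem_idealMultiples.mp hhN
    exact ⟨⟨j, hj⟩, rfl⟩

theorem idealMultiples_eq_bot_of_smul_notMem {r : K} (hJr : J = Ideal.span {r}) (hJbot : J ≠ ⊥)
    (hJtop : J ≠ ⊤) (hideals : ∀ I : Ideal K, I = ⊥ ∨ I = J ∨ I = ⊤)
    {H : Submodule K (Fin e ⊕ Fin e → K)} {u : Fin e ⊕ Fin e → K} (hru : r • u ∉ H) :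
    idealMultiples J H u = ⊥ := by
  refine (Submodule.eq_bot_iff _).mpr fun h hh => ?_
  obtain ⟨j, hj, hju⟩ := mem_idealMultiples.mp hh
  obtain ⟨c, rfl⟩ := Ideal.mem_span_singleton'.mp (hJr.le hj)
  have hc : c ∈ J := by
    by_contra hc
    obtain ⟨σ, rfl⟩ := isUnit_of_notMem_of_ideals hideals hc
    refine hru ((H.smul_mem_iff_of_isUnit σ.isUnit).mp ?_)
    rw [← mul_smul, hju]
    exact h.2
  rw [(mul_eq_zero_iff_mem_of_ideals hJr hJbot hJtop hideals).mpr hc, zero_smul] at hju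
  exact Subtype.ext hju.symm

end Classes

/-- Lemma: cardinality of `{[u+h] : h ∈ H}` depending on whether `r•u ∈ H`. -/
theorem card_classSet
    (K : Type) [CommRing K] [Fintype K]
    (J : Ideal K) (r : K) (q : ℕ)
    (hJr : J = Ideal.span {r})
    (hJbot : J ≠ ⊥) (hJtop : J ≠ ⊤)
    (hideals : ∀ I : Ideal K, I = ⊥ ∨ I = J ∨ I = ⊤)
    (hq : IsPrimePow q)
    (hqcard : Nat.card (K ⧸ J) = q)
    (e : ℕ) (he : 2 ≤ e)
    (H : Submodule K (Fin e ⊕ Fin e → K)) (hH : IsHyperplane K J e q H)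
    (u : Fin e ⊕ Fin e → K) (hu : u ∈ unitTuples K e) :
    (r • u ∈ H → Nat.card (classSet K e H u) = q ^ (2 * e - 2)) ∧
    (r • u ∉ H → Nat.card (classSet K e H u) = q ^ (2 * e - 1)) := by
  have hr := mul_self_eq_zero_of_ideals hJr hJtop hideals
  have hcard := card_eq_card_classSet_mul
    (fun x hx y hy => mul_eq_zero_of_mem_of_mem hJr hr hx hy) hH.1 hu
  rw [hH.2] at hcard
  constructor
  · intro hru
    rw [card_idealMultiples_of_smul_mem hJr hu hru,
      card_ideal_eq_card_quotient hJr hJbot hJtop hideals, hqcard,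
      show 2 * e - 1 = 2 * e - 2 + 1 by omega, pow_succ] at hcard
    exact (Nat.eq_of_mul_eq_mul_right hq.pos hcard).symm
  · intro hru
    rw [idealMultiples_eq_bot_of_smul_notMem hJr hJbot hJtop hideals hru] at hcard
    simpa using hcard.symm
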